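/- arXiv:1710.04115 — 4 statements merged into one kernel-verified Lean document; each statement's English description precedes it below -/
import Mathlib

section
/- Let A = (Σ, Q, Q₀, δ, α) be a GFG automaton and let g = (Σ, Q, M, m₀, ρ, τ) be a finite-state strategy witnessing A's GFGness. Then for every state q ∈ Q and every memory m of q (i.e., τ(m) = q) that is reachable in A_g from m₀, the languages coincide: L(A_g^m) = L(A^q). -/
namespace GFG

/-- The structure of a nondeterministic automaton on infinite words:
alphabet `A`, states `Q`, initial states and transition function.
The acceptance condition is kept separate, as a predicate on the set
of states visited infinitely often. -/
structure Auto (A Q : Type) where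
  init : Set Q
  next : Q → A → Set Q

variable {A Q Mem : Type}

/-- `r` is a run of the automaton `M` on the infinite word `w`. -/
def Auto.IsRun (M : Auto A Q) (w : ℕ → A) (r : ℕ → Q) : Prop :=
  r 0 ∈ M.init ∧ ∀ i, r (i + 1) ∈ M.next (r i) (w i)

/-- The set of states occurring infinitely often in `r`. -/
def InfOcc (r : ℕ → Q) : Set Q := {q | ∀ n, ∃ m, n ≤ m ∧ r m = q}

/-- The language of `M` with acceptance condition `acc` (a predicate on `inf(r)`). -/
def Auto.Lang (M : Auto A Q) (acc : Set Q → Prop) : Set (ℕ → A) :=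
  {w | ∃ r, M.IsRun w r ∧ acc (InfOcc r)}

/-- `M` is deterministic: one initial state and at most one successor per state/letter. -/
def Auto.IsDet (M : Auto A Q) : Prop :=
  (∃ q0, M.init = {q0}) ∧ ∀ q a, (M.next q a).Subsingleton

/-- `A^q`: the automaton `M` with set of initial states `{q}`. -/
def Auto.withInit (M : Auto A Q) (q : Q) : Auto A Q := ⟨{q}, M.next⟩

/-- Büchi condition: `inf(r) ∩ α ≠ ∅`. -/
def BuchiAcc (α : Set Q) (S : Set Q) : Prop := (S ∩ α).Nonempty

/-- co-Büchi condition: `inf(r) ∩ α = ∅`. -/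
def CoBuchiAcc (α : Set Q) (S : Set Q) : Prop := S ∩ α = ∅

/-- Rabin condition with bad sets `E i` and good sets `F i`. -/
def RabinAcc {ι : Type} (E F : ι → Set Q) (S : Set Q) : Prop :=
  ∃ i, S ∩ E i = ∅ ∧ (S ∩ F i).Nonempty

/-- Streett condition with pairs `(E i, F i)`. -/
def StreettAcc {ι : Type} (E F : ι → Set Q) (S : Set Q) : Prop :=
  ∀ i, S ∩ E i = ∅ ∨ (S ∩ F i).Nonempty

/-- Parity condition: the minimal priority seen infinitely often is even. -/
def ParityAcc (c : Q → ℕ) (S : Set Q) : Prop := Even (sInf (c '' S))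

/-- The prefix of length `n` of the infinite word `w`, as a list. -/
def prefixWord (w : ℕ → A) (n : ℕ) : List A := (List.range n).map w

/-- The run induced by a strategy `g : A* → Q` on the word `w`:
`g(ε), g(a₁), g(a₁a₂), …`. -/
def StrategyRun (g : List A → Q) (w : ℕ → A) : ℕ → Q := fun n => g (prefixWord w n)

/-- `g` witnesses GFGness of `M` (with acceptance `acc`): for every word `w` the
induced sequence is a run of `M` on `w`, accepting whenever `w ∈ L(M)`. -/
def IsGFGStrategy (M : Auto A Q) (acc : Set Q → Prop) (g : List A → Q) : Prop :=
  ∀ w : ℕ → A, M.IsRun w (StrategyRun g w) ∧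
    (w ∈ M.Lang acc → acc (InfOcc (StrategyRun g w)))

/-- `M` is good for games. -/
def IsGFG (M : Auto A Q) (acc : Set Q → Prop) : Prop :=
  ∃ g : List A → Q, IsGFGStrategy M acc g

/-- `M` is unambiguous: every word of the language has exactly one accepting run. -/
def Unambiguous (M : Auto A Q) (acc : Set Q → Prop) : Prop :=
  ∀ w ∈ M.Lang acc, ∃! r : ℕ → Q, M.IsRun w r ∧ acc (InfOcc r)

/-- `M` is determinizable by pruning. -/
def DetByP (M : Auto A Q) (acc : Set Q → Prop) : Prop :=
  ∃ q0 ∈ M.init, ∃ next' : Q → A → Set Q,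
    (∀ q a, next' q a ⊆ M.next q a ∧ (next' q a).Subsingleton) ∧
    (⟨{q0}, next'⟩ : Auto A Q).Lang acc = M.Lang acc

/-- A finite-state strategy (transducer): memories `Mem`, initial memory `m0`,
memory update function `upd` and output function `out`. -/
structure Transducer (A Q Mem : Type) where
  m0 : Mem
  upd : Mem → A → Mem
  out : Mem → Q

namespace Transducer

variable (T : Transducer A Q Mem)

/-- The memory reached from `m` after reading the finite word `u`. -/
def run (m : Mem) (u : List A) : Mem := u.foldl T.upd m

/-- The strategy generated by the transducer: `u ↦ τ(ρ(m₀, u))`. -/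
def strategy : List A → Q := fun u => T.out (T.run T.m0 u)

/-- The deterministic automaton `A_g`, with initial memory replaced by `m`. -/
def autoFrom (m : Mem) : Auto A Mem := ⟨{m}, fun m' a => {T.upd m' a}⟩

/-- The deterministic automaton `A_g` itself. -/
def auto : Auto A Mem := T.autoFrom T.m0

/-- The acceptance condition `α_g` of `A_g`, obtained from `acc` by replacing each
set `F ⊆ Q` appearing in it by `{m | τ(m) ∈ F}`. -/
def accG (acc : Set Q → Prop) : Set Mem → Prop := fun S => acc (T.out '' S)

/-- `m` is reachable in `A_g` from the initial memory. -/
def Reachable (m : Mem) : Prop := ∃ u : List A, T.run T.m0 u = m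

/-- The set of memories visited along the path of `A_g` that starts at `m` and
reads the finite word `u` (both endpoints included). -/
def pathStates (m : Mem) (u : List A) : Set Mem :=
  {m' | ∃ v : List A, v <+: u ∧ T.run m v = m'}

/-- `P_{src → dst}`: the (words inducing the) finite paths of `A_g` from `src` to `dst`. -/
def PathSet (src dst : Mem) : Set (List A) :=
  {u : List A | u ≠ [] ∧ T.run src u = dst}

/-- Every combination of paths from `P_{src → dst}` satisfies `α_g`. -/
def AllCombosAcc (acc : Set Q → Prop) (src dst : Mem) : Prop :=
  ∀ S : Set (List A), S.Nonempty → S ⊆ T.PathSet src dst →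
    T.accG acc (⋃ u ∈ S, T.pathStates src u)

/-- `P_{src → dst}` is empty, or every combination of its paths satisfies `α_g`. -/
def GoodPathSet (acc : Set Q → Prop) (src dst : Mem) : Prop :=
  T.PathSet src dst = ∅ ∨ T.AllCombosAcc acc src dst

/-- `m` is replaceable by `m'`: the set `P_{m' → m}` of paths of `A_g` from `m'`
to `m` is empty, or every combination of its paths satisfies `α_g`. -/
def Replaceable (acc : Set Q → Prop) (m m' : Mem) : Prop :=
  T.GoodPathSet acc m' m

/-- The transition `(q, a, q')` is used by the strategy. -/
def Uses (q : Q) (a : A) (q' : Q) : Prop :=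
  ∃ u : List A, T.strategy u = q ∧ T.strategy (u ++ [a]) = q'

/-- The nonempty word `u` induces a cycle of `A_g` through the memory `m`. -/
def CycleThrough (m : Mem) (u : List A) : Prop := u ≠ [] ∧ T.run m u = m

/-- The cycle of `A_g` through `m` induced by `u` is accepting. -/
def AccCycle (acc : Set Q → Prop) (m : Mem) (u : List A) : Prop :=
  T.CycleThrough m u ∧ T.accG acc (T.pathStates m u)

/-- The cycle of `A_g` through `m` induced by `u` is rejecting. -/
def RejCycle (acc : Set Q → Prop) (m : Mem) (u : List A) : Prop :=
  T.CycleThrough m u ∧ ¬ T.accG acc (T.pathStates m u)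

/-- The cycle of `A_g` through `m` induced by `u` is `q`-exclusive accepting:
it is accepting, but its set of memories minus the memories of `q` is not. -/
def ExclAccCycle (acc : Set Q → Prop) (q : Q) (m : Mem) (u : List A) : Prop :=
  T.CycleThrough m u ∧ T.accG acc (T.pathStates m u) ∧
    ¬ T.accG acc (T.pathStates m u \ {m' : Mem | T.out m' = q})

end Transducer

/-- `M` is weakly tight with respect to `T`: every transition of `M` is used. -/
def WeaklyTightWrt (M : Auto A Q) (T : Transducer A Q Mem) : Prop :=
  ∀ q a q', q' ∈ M.next q a → T.Uses q a q'

/-- `M` is tight with respect to `T`: every transition of `M` is used, and no memory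
is replaceable by a different memory of the same state. -/
def TightWrt (M : Auto A Q) (acc : Set Q → Prop) (T : Transducer A Q Mem) : Prop :=
  WeaklyTightWrt M T ∧
  ∀ m m' : Mem, m ≠ m' → T.out m = T.out m' → ¬ T.Replaceable acc m m'

/-- `M` is tight: tight with respect to some finite-state strategy witnessing its GFGness. -/
def Tight (M : Auto A Q) (acc : Set Q → Prop) : Prop :=
  ∃ (Mem : Type) (_ : Fintype Mem) (T : Transducer A Q Mem),
    IsGFGStrategy M acc T.strategy ∧ TightWrt M acc T

/-- `M` is weakly tight: weakly tight with respect to some finite-state strategy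
witnessing its GFGness. -/
def WeaklyTight (M : Auto A Q) (acc : Set Q → Prop) : Prop :=
  ∃ (Mem : Type) (_ : Fintype Mem) (T : Transducer A Q Mem),
    IsGFGStrategy M acc T.strategy ∧ WeaklyTightWrt M T

/-- A Rabin automaton `M` (with pairs `(E i, F i)`) is strongly tight with respect to `T`:
tight, and every state appearing in some good set has a `q`-exclusive accepting cycle
in `A_g`. -/
def StronglyTightWrt {ι : Type} (M : Auto A Q) (E F : ι → Set Q)
    (T : Transducer A Q Mem) : Prop :=
  TightWrt M (RabinAcc E F) T ∧
  ∀ q : Q, (∃ i, q ∈ F i) →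
    ∃ (m : Mem) (u : List A), T.ExclAccCycle (RabinAcc E F) q m u

/-- A Rabin automaton is strongly tight: strongly tight with respect to some finite-state
strategy witnessing its GFGness. -/
def StronglyTight {ι : Type} (M : Auto A Q) (E F : ι → Set Q) : Prop :=
  ∃ (Mem : Type) (_ : Fintype Mem) (T : Transducer A Q Mem),
    IsGFGStrategy M (RabinAcc E F) T.strategy ∧ StronglyTightWrt M E F T

/-- One-step reachability in the transition graph of `M`. -/
def Auto.Step (M : Auto A Q) (q q' : Q) : Prop := ∃ a, q' ∈ M.next q a

/-- Reachability in the transition graph of `M`. -/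
def Auto.Reach (M : Auto A Q) : Q → Q → Prop := Relation.ReflTransGen M.Step

/-- The Büchi automaton `(M, α)` is weak: each strongly connected component is either
contained in `α` or disjoint from `α`. -/
def Auto.IsWeak (M : Auto A Q) (α : Set Q) : Prop :=
  ∀ q q', M.Reach q q' → M.Reach q' q → (q ∈ α ↔ q' ∈ α)

theorem infOcc_shift {Q : Type} (f g : ℕ → Q) (k : ℕ) (h : ∀ n, f (n + k) = g n) :
    InfOcc f = InfOcc g := by
  ext q
  constructor
  · intro hf n
    obtain ⟨j, hj, e⟩ := hf (n + k)
    refine ⟨j - k, by omega, ?_⟩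
    rw [← h, Nat.sub_add_cancel (by omega), e]
  · intro hf n
    obtain ⟨j, hj, e⟩ := hf n
    exact ⟨j + k, by omega, by rw [h, e]⟩

theorem infOcc_image {Q Mem : Type} [Finite Mem] (o : Mem → Q) (f : ℕ → Mem) :
    InfOcc (fun n => o (f n)) = o '' InfOcc f := by
  ext q
  constructor
  · intro h
    by_contra hc
    have h1 : ∀ x : Mem, ∃ n, o x = q → ∀ j, n ≤ j → f j ≠ x := by
      intro x
      by_contra hx
      push Not at hx
      refine hc ⟨x, ?_, (hx 0).1⟩
      intro n
      obtain ⟨_, j, hj, e⟩ := hx n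
      exact ⟨j, hj, e⟩
    choose N hN using h1
    obtain ⟨B, hB⟩ := (Set.finite_range N).bddAbove
    obtain ⟨j, hj, e⟩ := h B
    exact hN (f j) e j (le_trans (hB ⟨f j, rfl⟩) hj) rfl
  · rintro ⟨x, hx, rfl⟩ n
    obtain ⟨j, hj, e⟩ := hx n
    exact ⟨j, hj, by simp only [e]⟩

/-- For a GFG automaton `M` with finite-state witnessing strategy `T`,
every reachable memory `m` of a state `q` satisfies `L(A_g^m) = L(A^q)`. -/
theorem stmt0 {A Q Mem : Type} [Fintype A] [Fintype Q] [Fintype Mem]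
    (M : Auto A Q) (acc : Set Q → Prop) (T : Transducer A Q Mem)
    (hg : IsGFGStrategy M acc T.strategy)
    (q : Q) (m : Mem) (hmem : T.out m = q) (hreach : T.Reachable m) :
    (T.autoFrom m).Lang (T.accG acc) = (M.withInit q).Lang acc := by
  obtain ⟨u, hu⟩ := hreach
  subst hmem
  ext w
  obtain ⟨w', hw1, hw2⟩ : ∃ w' : ℕ → A, prefixWord w' u.length = u ∧
      ∀ n, w' (n + u.length) = w n := by
    refine ⟨fun n => (u[n]?).getD (w (n - u.length)), ?_, ?_⟩
    · apply List.ext_getElem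
      · simp [prefixWord]
      · intro i h1 h2
        simp [prefixWord, h2]
    · intro n
      simp
  obtain ⟨R, hR⟩ : ∃ R : ℕ → Mem, R = fun n => T.run T.m0 (prefixWord w' n) := ⟨_, rfl⟩
  have hRs : ∀ n, R (n + 1) = T.upd (R n) (w' n) := by
    intro n
    simp [hR, prefixWord, Transducer.run, List.range_succ]
  have hRm : R u.length = m := by simp [hR, hw1, hu]
  have hstr : StrategyRun T.strategy w' = fun n => T.out (R n) := by
    rw [hR]; rfl
  obtain ⟨⟨hi, hrun⟩, hacc⟩ := hg w'
  rw [hstr] at hi hrun hacc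
  have hSs : ∀ n, R (n + 1 + u.length) = T.upd (R (n + u.length)) (w n) := by
    intro n
    rw [← hw2, ← hRs]; congr 1; omega
  have hMs : ∀ n, T.out (R (n + 1 + u.length)) ∈ M.next (T.out (R (n + u.length))) (w n) := by
    intro n
    rw [← hw2, show n + 1 + u.length = n + u.length + 1 by omega]
    exact hrun (n + u.length)
  constructor
  · rintro ⟨r, ⟨h0, hs⟩, ha⟩
    have hr : ∀ n, r n = R (n + u.length) := by
      intro n
      induction n with
      | zero => rw [Nat.zero_add, hRm]; exact h0
      | succ n ih => rw [hSs, ← ih]; exact hs n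
    refine ⟨fun n => T.out (r n), ⟨?_, ?_⟩, ?_⟩
    · change T.out (r 0) = T.out m
      rw [hr, Nat.zero_add, hRm]
    · intro n
      change T.out (r (n + 1)) ∈ M.next (T.out (r n)) (w n)
      rw [hr, hr]
      exact hMs n
    · rw [infOcc_image]; exact ha
  · rintro ⟨r, ⟨h0, hs⟩, ha⟩
    have h0 : r 0 = T.out m := h0
    have hs : ∀ n, r (n + 1) ∈ M.next (r n) (w n) := hs
    refine ⟨fun n => R (n + u.length), ⟨?_, hSs⟩, ?_⟩
    · change R (0 + u.length) = m
      rw [Nat.zero_add, hRm]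
    · change acc (T.out '' _)
      rw [← infOcc_image,
        ← infOcc_shift (fun n => T.out (R n)) (fun n => T.out (R (n + u.length))) u.length
          (fun _ => rfl)]
      apply hacc
      obtain ⟨r', hr'⟩ : ∃ r' : ℕ → Q, r' = fun n =>
        if n < u.length then T.out (R n) else r (n - u.length) := ⟨_, rfl⟩
      have hlo : ∀ n, n ≤ u.length → r' n = T.out (R n) := by
        intro n hn
        rcases hn.lt_or_eq with h | h
        · simp [hr', h]
        · simp [hr', h, hRm, h0]
      have hhi : ∀ n, r' (n + u.length) = r n := by
        intro n
        simp [hr']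
      refine ⟨r', ⟨?_, ?_⟩, ?_⟩
      · rw [hlo 0 (Nat.zero_le _)]; exact hi
      · intro n
        by_cases h : n < u.length
        · rw [hlo n h.le, hlo (n + 1) h]; exact hrun n
        · obtain ⟨k, rfl⟩ : ∃ k, n = k + u.length := ⟨n - u.length, by omega⟩
          rw [show k + u.length + 1 = k + 1 + u.length by omega, hhi, hhi, hw2]
          exact hs k
      · rw [infOcc_shift r' r u.length hhi]; exact ha

end GFG
end

section
/- Let A = (Σ, Q, Q₀, δ, α) be a GFG automaton and let g = (Σ, Q, M, m₀, ρ, τ) be a finite-state strategy witnessing A's GFGness. Then for all memories m, m' ∈ M that are reachable in A_g from m₀ and satisfy τ(m) = τ(m'), the languages coincide: L(A_g^m) = L(A_g^{m'}). -/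
namespace GFG

variable {A Q Mem : Type}

/-- Prepend a finite word to an infinite one. -/
def catWord (u : List A) (w : ℕ → A) : ℕ → A :=
  fun n => if h : n < u.length then u[n] else w (n - u.length)

theorem catWord_add (u : List A) (w : ℕ → A) (n : ℕ) :
    catWord u w (n + u.length) = w n := by
  simp [catWord]

theorem prefixWord_succ (w : ℕ → A) (n : ℕ) :
    prefixWord w (n + 1) = prefixWord w n ++ [w n] := by
  simp [prefixWord, List.range_succ]

theorem prefixWord_cat (u : List A) (w : ℕ → A) (n : ℕ) :
    prefixWord (catWord u w) (n + u.length) = u ++ prefixWord w n := by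
  induction n with
  | zero =>
    apply List.ext_getElem
    · simp [prefixWord]
    · intro i h1 h2
      have h3 : i < u.length := by simpa [prefixWord] using h2
      simp [prefixWord, catWord, h3]
  | succ n ih =>
    rw [show n + 1 + u.length = (n + u.length) + 1 by omega, prefixWord_succ, ih,
      catWord_add, prefixWord_succ, List.append_assoc]

theorem InfOcc_shift (r : ℕ → Q) (k : ℕ) : InfOcc (fun n => r (n + k)) = InfOcc r := by
  ext q
  constructor
  · intro h n
    obtain ⟨j, hj, e⟩ := h n
    exact ⟨j + k, by omega, e⟩
  · intro h n
    obtain ⟨j, hj, e⟩ := h (n + k)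
    refine ⟨j - k, by omega, ?_⟩
    show r (j - k + k) = q
    rwa [Nat.sub_add_cancel (by omega)]

theorem InfOcc_comp [Finite Mem] (f : Mem → Q) (s : ℕ → Mem) :
    InfOcc (fun n => f (s n)) = f '' InfOcc s := by
  ext q
  constructor
  · intro h
    by_contra hc
    have h1 : ∀ x : Mem, ∃ N, f x = q → ∀ j, N ≤ j → s j ≠ x := by
      intro x
      by_cases hx : f x = q
      · by_contra hN
        apply hc
        refine ⟨x, ?_, hx⟩
        intro n
        by_contra hn
        apply hN
        exact ⟨n, fun _ j hj e => hn ⟨j, hj, e⟩⟩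
      · exact ⟨0, fun h => absurd h hx⟩
    choose N hN using h1
    obtain ⟨B, hB⟩ := (Set.finite_range N).bddAbove
    obtain ⟨j, hj, e⟩ := h B
    exact hN (s j) e j (le_trans (hB ⟨s j, rfl⟩) hj) rfl
  · rintro ⟨x, hx, rfl⟩ n
    obtain ⟨j, hj, e⟩ := hx n
    exact ⟨j, hj, by rw [← e]⟩

theorem run_append (T : Transducer A Q Mem) (m : Mem) (u v : List A) :
    T.run m (u ++ v) = T.run (T.run m u) v := by
  simp [Transducer.run]

theorem mem_lang_iff [Finite Mem] (acc : Set Q → Prop) (T : Transducer A Q Mem) (m : Mem)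
    (w : ℕ → A) : w ∈ (T.autoFrom m).Lang (T.accG acc) ↔
      acc (InfOcc (fun n => T.out (T.run m (prefixWord w n)))) := by
  rw [InfOcc_comp]
  constructor
  · rintro ⟨r, ⟨h0, h1⟩, h2⟩
    have : r = fun n => T.run m (prefixWord w n) := by
      funext n
      induction n with
      | zero => exact h0
      | succ n ih =>
        have := h1 n
        rw [prefixWord_succ, run_append, ← ih]
        exact this
    rw [← this]
    exact h2
  · intro h
    refine ⟨fun n => T.run m (prefixWord w n), ⟨rfl, fun i => ?_⟩, h⟩
    show T.run m (prefixWord w (i + 1)) = _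
    rw [prefixWord_succ, run_append]
    rfl

theorem strategyRun_cat (T : Transducer A Q Mem) (u : List A) (w : ℕ → A) (n : ℕ) :
    StrategyRun T.strategy (catWord u w) (n + u.length) =
      T.out (T.run (T.run T.m0 u) (prefixWord w n)) := by
  simp only [StrategyRun, Transducer.strategy, prefixWord_cat, run_append]

theorem stmt1_sub [Finite Mem] (M : Auto A Q) (acc : Set Q → Prop) (T : Transducer A Q Mem)
    (hg : IsGFGStrategy M acc T.strategy) (u u' : List A)
    (hsame : T.out (T.run T.m0 u) = T.out (T.run T.m0 u')) :
    (T.autoFrom (T.run T.m0 u)).Lang (T.accG acc) ⊆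
      (T.autoFrom (T.run T.m0 u')).Lang (T.accG acc) := by
  intro w hw
  rw [mem_lang_iff] at hw ⊢
  have key : catWord u' w ∈ M.Lang acc := by
    let R : ℕ → Q := fun n => if n < u'.length then StrategyRun T.strategy (catWord u' w) n
      else StrategyRun T.strategy (catWord u w) (n - u'.length + u.length)
    have hle : ∀ n, n ≤ u'.length → R n = StrategyRun T.strategy (catWord u' w) n := by
      intro n hn
      rcases hn.lt_or_eq with h | h
      · simp [R, h]
      · have e1 := strategyRun_cat T u w 0
        have e2 := strategyRun_cat T u' w 0
        simp only [Nat.zero_add, prefixWord, List.range_zero, List.map_nil] at e1 e2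
        subst h
        simp only [R, lt_irrefl, if_false, Nat.sub_self, Nat.zero_add]
        rw [e1, e2]
        exact hsame
    have hge : ∀ n, R (n + u'.length) = StrategyRun T.strategy (catWord u w) (n + u.length) := by
      intro n
      simp [R]
    refine ⟨R, ⟨?_, ?_⟩, ?_⟩
    · rw [hle 0 (Nat.zero_le _)]
      exact (hg _).1.1
    · intro i
      by_cases hi : i < u'.length
      · rw [hle i hi.le, hle (i + 1) hi]
        exact (hg _).1.2 i
      · obtain ⟨n, rfl⟩ : ∃ n, i = n + u'.length := ⟨i - u'.length, by omega⟩
        rw [show n + u'.length + 1 = (n + 1) + u'.length by omega, hge, hge, catWord_add]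
        have := (hg (catWord u w)).1.2 (n + u.length)
        rw [catWord_add] at this
        rwa [show n + 1 + u.length = n + u.length + 1 by omega]
    · rw [← InfOcc_shift R u'.length]
      simp only [hge, strategyRun_cat]
      exact hw
  have := (hg _).2 key
  rw [← InfOcc_shift _ u'.length] at this
  simpa only [strategyRun_cat] using this

/-- For a GFG automaton `M` with finite-state witnessing strategy `T`,
any two reachable memories of the same state have the same language in `A_g`. -/
theorem stmt1 {A Q Mem : Type} [Fintype A] [Fintype Q] [Fintype Mem]
    (M : Auto A Q) (acc : Set Q → Prop) (T : Transducer A Q Mem)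
    (hg : IsGFGStrategy M acc T.strategy)
    (m m' : Mem) (hreach : T.Reachable m) (hreach' : T.Reachable m')
    (hsame : T.out m = T.out m') :
    (T.autoFrom m).Lang (T.accG acc) = (T.autoFrom m').Lang (T.accG acc) := by
  obtain ⟨u, rfl⟩ := hreach
  obtain ⟨u', rfl⟩ := hreach'
  exact Set.Subset.antisymm (stmt1_sub M acc T hg u u' hsame)
    (stmt1_sub M acc T hg u' u hsame.symm)

end GFG
end

section
/- Unambiguous nondeterministic parity automata are not Büchi-type with respect to DBW-realizable languages: there exists an unambiguous nondeterministic parity automaton A = (Σ, Q, Q₀, δ, α) such that L(A) is recognized by some deterministic Büchi automaton, yet there is no Büchi condition α' ⊆ Q for which the automaton (Σ, Q, Q₀, δ, α') is equivalent to A. -/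
namespace GFG

variable {A Q Mem : Type}

/-- Transition table of the witness; letters `a = 0`, `b = 1`, `c = 2`. -/
def stp (q : Fin 6) (a : Fin 3) : Fin 6 :=
  if q = 0 then ![1, 2, 0] a
  else if q = 1 then ![2, 2, 0] a
  else if q = 2 then ![1, 2, 0] a
  else if q = 4 then ![5, 4, 4] a
  else ![3, 4, 3] a

def wit : Auto (Fin 3) (Fin 6) := ⟨{0, 3}, fun q a => {stp q a}⟩

def prio (q : Fin 6) : ℕ := if q = 0 then 3 else if q = 2 then 2 else if q = 5 then 0 else 1

def rn (q : Fin 6) (w : ℕ → Fin 3) : ℕ → Fin 6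
  | 0 => q
  | n + 1 => stp (rn q w n) (w n)

def InfLetter (w : ℕ → Fin 3) (a : Fin 3) : Prop := ∀ n, ∃ m, n ≤ m ∧ w m = a

theorem isRun_rn (q : Fin 6) (hq : q = 0 ∨ q = 3) (w : ℕ → Fin 3) : wit.IsRun w (rn q w) := by
  refine ⟨?_, fun i => ?_⟩
  · simpa [wit, rn] using hq
  · simp [wit, rn]

theorem isRun_cases {w : ℕ → Fin 3} {r : ℕ → Fin 6} (h : wit.IsRun w r) :
    r = rn 0 w ∨ r = rn 3 w := by
  obtain ⟨h0, h1⟩ := h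
  have key : ∀ q, r 0 = q → r = rn q w := by
    intro q hq
    funext n
    induction n with
    | zero => simpa [rn] using hq
    | succ n ih =>
      have := h1 n
      simp only [wit, Set.mem_singleton_iff] at this
      rw [this, ih, rn]
  have : r 0 = 0 ∨ r 0 = 3 := by simpa [wit] using h0
  rcases this with h | h
  · exact Or.inl (key _ h)
  · exact Or.inr (key _ h)

theorem infOcc_nonempty (r : ℕ → Fin 6) : (InfOcc r).Nonempty := by
  by_contra hne
  rw [Set.not_nonempty_iff_eq_empty] at hne
  have h : ∀ q, ∃ n, ∀ m, n ≤ m → r m ≠ q := by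
    intro q
    have : q ∉ InfOcc r := by simp [hne]
    simpa [InfOcc] using this
  choose f hf using h
  exact hf (r (Finset.univ.sup f)) _ (Finset.le_sup (Finset.mem_univ _)) rfl

theorem infOcc_inv {r : ℕ → Fin 6} {P : Fin 6 → Prop} (h : ∀ n, P (r n)) :
    ∀ q ∈ InfOcc r, P q := by
  intro q hq
  obtain ⟨m, -, rfl⟩ := hq 0
  exact h m

theorem parity_eq {S : Set (Fin 6)} (q : Fin 6) (hq : q ∈ S) (h : ∀ p ∈ S, prio q ≤ prio p) :
    ParityAcc prio S ↔ Even (prio q) := by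
  have : sInf (prio '' S) = prio q := by
    apply le_antisymm
    · exact Nat.sInf_le ⟨q, hq, rfl⟩
    · refine le_csInf ⟨_, q, hq, rfl⟩ ?_
      rintro _ ⟨p, hp, rfl⟩
      exact h p hp
  unfold ParityAcc
  rw [this]

theorem stp_low : ∀ q a, (q = 0 ∨ q = 1 ∨ q = 2) → (stp q a = 0 ∨ stp q a = 1 ∨ stp q a = 2) := by
  decide
theorem stp_high : ∀ q a, (q = 3 ∨ q = 4 ∨ q = 5) → (stp q a = 3 ∨ stp q a = 4 ∨ stp q a = 5) := by
  decide
theorem stp_to1 : ∀ q a, stp q a = 1 → a = 0 := by decide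
theorem stp_a_low : ∀ q, (q = 0 ∨ q = 1 ∨ q = 2) → q = 1 ∨ stp q 0 = 1 := by decide
theorem stp_b_low : ∀ q, (q = 0 ∨ q = 1 ∨ q = 2) → stp q 1 = 2 := by decide
theorem stp_to2 : ∀ q a, stp q a = 2 → a = 0 ∨ a = 1 := by decide
theorem stp_to5 : ∀ q a, stp q a = 5 → a = 0 := by decide
theorem stp_no5 : ∀ q a, (q = 3 ∨ q = 5) → a ≠ 1 → stp q a = 3 := by decide
theorem stp_b_high : ∀ q, (q = 3 ∨ q = 4 ∨ q = 5) → stp q 1 = 4 := by decide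
theorem stp_4 : ∀ a, stp 4 a = 4 ∨ stp 4 a = 5 := by decide
theorem stp_4a : stp 4 0 = 5 := by decide

theorem rn_low (w : ℕ → Fin 3) (n : ℕ) : rn 0 w n = 0 ∨ rn 0 w n = 1 ∨ rn 0 w n = 2 := by
  induction n with
  | zero => simp [rn]
  | succ n ih => exact stp_low _ _ ih

theorem rn_high (w : ℕ → Fin 3) (n : ℕ) : rn 3 w n = 3 ∨ rn 3 w n = 4 ∨ rn 3 w n = 5 := by
  induction n with
  | zero => simp [rn]
  | succ n ih => exact stp_high _ _ ih

theorem inf1 (w : ℕ → Fin 3) : 1 ∈ InfOcc (rn 0 w) ↔ InfLetter w 0 := by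
  constructor
  · intro h n
    obtain ⟨m, hm, h1⟩ := h (n + 1)
    obtain ⟨k, rfl⟩ : ∃ k, m = k + 1 := ⟨m - 1, by omega⟩
    exact ⟨k, by omega, stp_to1 _ _ h1⟩
  · intro h n
    obtain ⟨m, hm, h1⟩ := h n
    rcases stp_a_low _ (rn_low w m) with h2 | h2
    · exact ⟨m, hm, h2⟩
    · exact ⟨m + 1, by omega, by rw [rn, h1, h2]⟩

theorem inf2 (w : ℕ → Fin 3) (ha : ¬ InfLetter w 0) : 2 ∈ InfOcc (rn 0 w) ↔ InfLetter w 1 := by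
  constructor
  · intro h n
    simp only [InfLetter, not_forall, not_exists, not_and] at ha
    obtain ⟨N, hN⟩ := ha
    obtain ⟨m, hm, h1⟩ := h (max n N + 1)
    obtain ⟨k, rfl⟩ : ∃ k, m = k + 1 := ⟨m - 1, by omega⟩
    rcases stp_to2 _ _ h1 with h2 | h2
    · exact absurd h2 (hN k (by omega))
    · exact ⟨k, by omega, h2⟩
  · intro h n
    obtain ⟨m, hm, h1⟩ := h n
    exact ⟨m + 1, by omega, by rw [rn, h1]; exact stp_b_low _ (rn_low w m)⟩

theorem inf5a (w : ℕ → Fin 3) (q : Fin 6) (h : 5 ∈ InfOcc (rn q w)) : InfLetter w 0 := by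
  intro n
  obtain ⟨m, hm, h1⟩ := h (n + 1)
  obtain ⟨k, rfl⟩ : ∃ k, m = k + 1 := ⟨m - 1, by omega⟩
  exact ⟨k, by omega, stp_to5 _ _ h1⟩

theorem inf5 (w : ℕ → Fin 3) : 5 ∈ InfOcc (rn 3 w) ↔ InfLetter w 0 ∧ InfLetter w 1 := by
  constructor
  · intro h
    refine ⟨inf5a w _ h, ?_⟩
    by_contra hb
    simp only [InfLetter, not_forall, not_exists, not_and] at hb
    obtain ⟨N, hN⟩ := hb
    obtain ⟨m, hm, h1⟩ := h N
    have key : ∀ k, rn 3 w (m + 1 + k) = 3 := by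
      intro k
      induction k with
      | zero => exact stp_no5 _ _ (Or.inr h1) (hN _ hm)
      | succ k ih => exact stp_no5 _ _ (Or.inl ih) (hN (m + 1 + k) (by omega))
    obtain ⟨m', hm', h2⟩ := h (m + 1)
    have := key (m' - (m + 1))
    rw [show m + 1 + (m' - (m + 1)) = m' by omega, h2] at this
    exact absurd this (by decide)
  · rintro ⟨ha, hb⟩ n
    obtain ⟨m, hm, h1⟩ := hb n
    have key : ∀ k, rn 3 w (m + 1 + k) = 4 ∨ ∃ j, n ≤ j ∧ rn 3 w j = 5 := by
      intro k
      induction k with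
      | zero => left; show stp _ _ = 4; rw [h1]; exact stp_b_high _ (rn_high w m)
      | succ k ih =>
        rcases ih with ih | ih
        · have e : rn 3 w (m + 1 + (k + 1)) = stp 4 (w (m + 1 + k)) := by
            rw [← ih]; rfl
          rcases stp_4 (w (m + 1 + k)) with h | h
          · left; rw [e, h]
          · right; exact ⟨m + 1 + (k + 1), by omega, by rw [e, h]⟩
        · exact Or.inr ih
    obtain ⟨l, hl, h2⟩ := ha (m + 1)
    rcases key (l - (m + 1)) with h | h
    · rw [show m + 1 + (l - (m + 1)) = l by omega] at h
      exact ⟨l + 1, by omega, by rw [rn, h, h2, stp_4a]⟩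
    · exact h

theorem acc_low (w : ℕ → Fin 3) :
    ParityAcc prio (InfOcc (rn 0 w)) ↔ ¬ InfLetter w 0 ∧ InfLetter w 1 := by
  have hS := infOcc_inv (P := fun q => q = 0 ∨ q = 1 ∨ q = 2) (rn_low w)
  by_cases ha : InfLetter w 0
  · rw [parity_eq 1 ((inf1 w).2 ha)]
    · simp [ha, prio]
    · intro p hp
      rcases hS p hp with rfl | rfl | rfl <;> decide
  · have h1 : 1 ∉ InfOcc (rn 0 w) := fun h => ha ((inf1 w).1 h)
    by_cases hb : InfLetter w 1
    · rw [parity_eq 2 ((inf2 w ha).2 hb)]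
      · simp [ha, hb, prio]
      · intro p hp
        rcases hS p hp with rfl | rfl | rfl
        · decide
        · exact absurd hp h1
        · decide
    · have h2 : 2 ∉ InfOcc (rn 0 w) := fun h => hb ((inf2 w ha).1 h)
      have h0 : ∀ p ∈ InfOcc (rn 0 w), p = 0 := by
        intro p hp
        rcases hS p hp with rfl | rfl | rfl
        · rfl
        · exact absurd hp h1
        · exact absurd hp h2
      obtain ⟨p, hp⟩ := infOcc_nonempty (rn 0 w)
      obtain rfl := h0 p hp
      rw [parity_eq 0 hp]
      · simp only [hb, and_false, iff_false]; decide
      · intro p hp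
        rw [h0 p hp]

theorem acc_high (w : ℕ → Fin 3) :
    ParityAcc prio (InfOcc (rn 3 w)) ↔ InfLetter w 0 ∧ InfLetter w 1 := by
  have hS := infOcc_inv (P := fun q => q = 3 ∨ q = 4 ∨ q = 5) (rn_high w)
  rw [← inf5]
  by_cases h5 : 5 ∈ InfOcc (rn 3 w)
  · rw [parity_eq 5 h5]
    · simp [h5, prio]
    · intro p hp
      rcases hS p hp with rfl | rfl | rfl <;> decide
  · obtain ⟨q, hq⟩ := infOcc_nonempty (rn 3 w)
    have h1 : ∀ p ∈ InfOcc (rn 3 w), prio p = 1 := by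
      intro p hp
      rcases hS p hp with rfl | rfl | rfl
      · decide
      · decide
      · exact absurd hp h5
    rw [parity_eq q hq, h1 q hq]
    · simp [h5]
    · intro p hp
      rw [h1 p hp, h1 q hq]

theorem lang_wit : wit.Lang (ParityAcc prio) = {w | InfLetter w 1} := by
  ext w
  constructor
  · rintro ⟨r, hr, ha⟩
    rcases isRun_cases hr with rfl | rfl
    · exact ((acc_low w).1 ha).2
    · exact ((acc_high w).1 ha).2
  · intro hb
    by_cases ha : InfLetter w 0
    · exact ⟨_, isRun_rn 3 (Or.inr rfl) w, (acc_high w).2 ⟨ha, hb⟩⟩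
    · exact ⟨_, isRun_rn 0 (Or.inl rfl) w, (acc_low w).2 ⟨ha, hb⟩⟩

theorem unamb_wit : Unambiguous wit (ParityAcc prio) := by
  rintro w ⟨r, hr, ha⟩
  refine ⟨r, ⟨hr, ha⟩, ?_⟩
  rintro r' ⟨hr', ha'⟩
  rcases isRun_cases hr with rfl | rfl <;> rcases isRun_cases hr' with rfl | rfl
  · rfl
  · exact absurd ((acc_high w).1 ha').1 ((acc_low w).1 ha).1
  · exact absurd ((acc_high w).1 ha).1 ((acc_low w).1 ha').1
  · rfl

def dbw : Auto (Fin 3) Bool := ⟨{false}, fun _ a => {decide (a = 1)}⟩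

def dr (w : ℕ → Fin 3) : ℕ → Bool
  | 0 => false
  | n + 1 => decide (w n = 1)

theorem lang_dbw : dbw.Lang (BuchiAcc {true}) = {w | InfLetter w 1} := by
  ext w
  constructor
  · rintro ⟨r, ⟨-, hr⟩, q, hq, hqt⟩ n
    obtain rfl : q = true := hqt
    obtain ⟨m, hm, h1⟩ := hq (n + 1)
    obtain ⟨k, rfl⟩ : ∃ k, m = k + 1 := ⟨m - 1, by omega⟩
    have : r (k + 1) = decide (w k = 1) := hr k
    rw [h1] at this
    exact ⟨k, by omega, of_decide_eq_true this.symm⟩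
  · intro hb
    refine ⟨dr w, ⟨Set.mem_singleton _, fun i => Set.mem_singleton _⟩,
      true, ?_, rfl⟩
    intro n
    obtain ⟨m, hm, h1⟩ := hb n
    exact ⟨m + 1, by omega, by simp [dr, h1]⟩

theorem not_mem_of_rn {α' : Set (Fin 6)} (h : wit.Lang (BuchiAcc α') = {w | InfLetter w 1})
    (w : ℕ → Fin 3) (hw : ¬ InfLetter w 1) (q : Fin 6) (hq : q = 0 ∨ q = 3) (p : Fin 6)
    (hp : p ∈ InfOcc (rn q w)) : p ∉ α' := by
  intro hpa
  have : w ∈ wit.Lang (BuchiAcc α') := ⟨_, isRun_rn q hq w, p, hp, hpa⟩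
  rw [h] at this
  exact hw this

theorem stay (q p : Fin 6) (w : ℕ → Fin 3) (N : ℕ) (h0 : rn q w N = p)
    (h : ∀ n, N ≤ n → stp p (w n) = p) : p ∈ InfOcc (rn q w) := by
  have : ∀ k, rn q w (N + k) = p := by
    intro k
    induction k with
    | zero => exact h0
    | succ k ih =>
      show stp (rn q w (N + k)) (w (N + k)) = p
      rw [ih]; exact h _ (by omega)
  intro n
  exact ⟨N + n, by omega, this n⟩

theorem not_type : ¬ ∃ α' : Set (Fin 6), wit.Lang (BuchiAcc α') = wit.Lang (ParityAcc prio) := by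
  rintro ⟨α', h⟩
  rw [lang_wit] at h
  have na : ¬ InfLetter (fun _ => 0) 1 := fun h => by obtain ⟨m, -, h⟩ := h 0; simp at h
  have nc : ¬ InfLetter (fun _ => 2) 1 := fun h => by obtain ⟨m, -, h⟩ := h 0; simp at h
  have nbc : ¬ InfLetter (fun n => if n = 0 then 1 else 2) 1 := fun h => by
    obtain ⟨m, hm, h⟩ := h 1
    simp only [show m ≠ 0 by omega, if_false] at h
    exact absurd h (by decide)
  have h0 : (0 : Fin 6) ∉ α' := not_mem_of_rn h _ nc 0 (Or.inl rfl) 0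
    (stay _ _ _ 0 rfl (fun _ _ => by decide))
  have h3 : (3 : Fin 6) ∉ α' := not_mem_of_rn h _ na 3 (Or.inr rfl) 3
    (stay _ _ _ 0 rfl (fun _ _ => by decide))
  have h4 : (4 : Fin 6) ∉ α' := not_mem_of_rn h _ nbc 3 (Or.inr rfl) 4
    (stay _ _ _ 1 (by decide) (fun n hn => by
      simp only [show n ≠ 0 by omega, if_false]; decide))
  have alt : ∀ k, rn 0 (fun _ => 0) (2 * k + 1) = 1 ∧ rn 0 (fun _ => 0) (2 * k + 2) = 2 := by
    intro k
    induction k with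
    | zero => decide
    | succ k ih =>
      have e1 : rn 0 (fun _ => 0) (2 * (k + 1) + 1) = 1 := by
        show stp (rn 0 (fun _ => 0) (2 * k + 2)) 0 = 1
        rw [ih.2]; decide
      refine ⟨e1, ?_⟩
      show stp (rn 0 (fun _ => 0) (2 * (k + 1) + 1)) 0 = 2
      rw [e1]; decide
  have h1 : (1 : Fin 6) ∉ α' := not_mem_of_rn h _ na 0 (Or.inl rfl) 1
    (fun n => ⟨2 * n + 1, by omega, (alt n).1⟩)
  have h2 : (2 : Fin 6) ∉ α' := not_mem_of_rn h _ na 0 (Or.inl rfl) 2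
    (fun n => ⟨2 * n + 2, by omega, (alt n).2⟩)
  have hb : (fun _ => 1 : ℕ → Fin 3) ∈ wit.Lang (BuchiAcc α') := by
    rw [h]; exact fun n => ⟨n, le_rfl, rfl⟩
  obtain ⟨r, hr, p, hp, hpa⟩ := hb
  have h5 : p = 5 := by
    fin_cases p
    · exact absurd hpa h0
    · exact absurd hpa h1
    · exact absurd hpa h2
    · exact absurd hpa h3
    · exact absurd hpa h4
    · rfl
  subst h5
  have : InfLetter (fun _ => 1) 0 := by
    rcases isRun_cases hr with rfl | rfl <;> exact inf5a _ _ hp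
  obtain ⟨m, -, h⟩ := this 0
  simp at h

/-- There is an unambiguous nondeterministic parity automaton whose
language is DBW-realizable, yet no Büchi condition on the same structure yields an
equivalent automaton. -/
theorem stmt4 :
    ∃ (A Q : Type) (_ : Fintype A) (_ : Fintype Q)
      (M : Auto A Q) (c : Q → ℕ),
      Unambiguous M (ParityAcc c) ∧
      (∃ (Q' : Type) (_ : Fintype Q') (D : Auto A Q') (β : Set Q'),
        D.IsDet ∧ D.Lang (BuchiAcc β) = M.Lang (ParityAcc c)) ∧
      ¬ ∃ α' : Set Q, M.Lang (BuchiAcc α') = M.Lang (ParityAcc c) := by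
  refine ⟨Fin 3, Fin 6, inferInstance, inferInstance, wit, prio, unamb_wit,
    ⟨Bool, inferInstance, dbw, {true}, ⟨⟨false, rfl⟩, fun q a => ?_⟩, ?_⟩, not_type⟩
  · exact Set.subsingleton_singleton
  · rw [lang_dbw, lang_wit]

end GFG
end

section
/- Unambiguous nondeterministic Büchi automata are not co-Büchi-type with respect to DCW-realizable languages: there exists an unambiguous nondeterministic Büchi automaton A = (Σ, Q, Q₀, δ, α) such that L(A) is recognized by some deterministic co-Büchi automaton, yet there is no co-Büchi condition α' ⊆ Q for which the automaton (Σ, Q, Q₀, δ, α') is equivalent to A. -/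
namespace GFG

variable {A Q Mem : Type}

/-- witness automaton -/
def exM : Auto Bool (Bool × Bool) where
  init := {q | q.2 = false}
  next := fun q x => {q' | q'.1 = q.1 ∧
    (q.1 = true → q'.2 = x) ∧
    (q.1 = false → (q.2 = true → x = false ∧ q'.2 = true) ∧
      (q.2 = false → q'.2 = true → x = true))}

/-- witness acceptance set -/
def exα : Set (Bool × Bool) := {q | q.2 = true}

theorem exM_comp {w : ℕ → Bool} {r : ℕ → Bool × Bool} (h : exM.IsRun w r) (n : ℕ) :
    (r n).1 = (r 0).1 := by
  induction n with
  | zero => rfl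
  | succ n ih => rw [← ih]; exact (h.2 n).1

theorem exM_one {w : ℕ → Bool} {r : ℕ → Bool × Bool} (h : exM.IsRun w r)
    (h0 : (r 0).1 = true) : r 0 = (true, false) ∧ ∀ n, r (n + 1) = (true, w n) := by
  refine ⟨Prod.ext h0 h.1, fun n => Prod.ext ?_ ?_⟩
  · rw [exM_comp h, h0]
  · exact (h.2 n).2.1 (by rw [exM_comp h, h0])

theorem exM_two {w : ℕ → Bool} {r : ℕ → Bool × Bool} (h : exM.IsRun w r)
    (h0 : (r 0).1 = false) (hN : ∃ N, (r N).2 = true) :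
    ∃ k, w k = true ∧ (∀ m, k < m → w m = false) ∧ ∀ n, r n = (false, decide (k < n)) := by
  classical
  have hc : ∀ n, (r n).1 = false := fun n => by rw [exM_comp h, h0]
  have hs := fun n => (h.2 n).2.2 (hc n)
  obtain ⟨N, hN1, hmin⟩ : ∃ N, (r N).2 = true ∧ ∀ m, m < N → (r m).2 = false :=
    ⟨Nat.find hN, Nat.find_spec hN, fun m hm => by simpa using Nat.find_min hN hm⟩
  cases N with
  | zero => have := h.1; simp [exM, hN1] at this
  | succ k =>
    have hp : ∀ d, (r (k + 1 + d)).2 = true := by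
      intro d
      induction d with
      | zero => exact hN1
      | succ d ih => exact ((hs (k + 1 + d)).1 ih).2
    have hp' : ∀ m, k < m → (r m).2 = true := by
      intro m hm
      obtain ⟨d, rfl⟩ := Nat.exists_eq_add_of_le (Nat.succ_le_of_lt hm)
      exact hp d
    refine ⟨k, (hs k).2 (hmin k (Nat.lt_succ_self k)) hN1,
      fun m hm => ((hs m).1 (hp' m hm)).1, fun n => Prod.ext (hc n) ?_⟩
    by_cases hn : k < n
    · simp [hn, hp' n hn]
    · simp [hn, hmin n (by omega)]

theorem exM_acc {w : ℕ → Bool} {r : ℕ → Bool × Bool} (h : exM.IsRun w r)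
    (ha : BuchiAcc exα (InfOcc r)) :
    ((∀ n, ∃ m, n ≤ m ∧ w m = true) ∧ r 0 = (true, false) ∧ ∀ n, r (n + 1) = (true, w n)) ∨
    ∃ k, w k = true ∧ (∀ m, k < m → w m = false) ∧ ∀ n, r n = (false, decide (k < n)) := by
  obtain ⟨q, hq, hqa⟩ := ha
  change q.2 = true at hqa
  cases h0 : (r 0).1 with
  | true =>
    left
    obtain ⟨h1, h2⟩ := exM_one h h0
    refine ⟨fun n => ?_, h1, h2⟩
    obtain ⟨m, hm, hr⟩ := hq (n + 1)
    obtain ⟨d, rfl⟩ : ∃ d, m = d + 1 := ⟨m - 1, by omega⟩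
    refine ⟨d, by omega, ?_⟩
    rw [h2] at hr
    rw [← hr] at hqa
    exact hqa
  | false =>
    right
    obtain ⟨m, hm, hr⟩ := hq 0
    exact exM_two h h0 ⟨m, by rw [hr, hqa]⟩

theorem exM_unamb : Unambiguous exM (BuchiAcc exα) := by
  rintro w ⟨r, hr, ha⟩
  refine ⟨r, ⟨hr, ha⟩, ?_⟩
  rintro r' ⟨hr', ha'⟩
  rcases exM_acc hr ha with ⟨hi, h0, h1⟩ | ⟨k, hk, hl, h1⟩ <;>
  rcases exM_acc hr' ha' with ⟨hi', h0', h1'⟩ | ⟨k', hk', hl', h1'⟩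
  · funext n
    cases n with
    | zero => rw [h0, h0']
    | succ n => rw [h1, h1']
  · obtain ⟨m, hm, hw⟩ := hi (k' + 1)
    rw [hl' m hm] at hw
    cases hw
  · obtain ⟨m, hm, hw⟩ := hi' (k + 1)
    rw [hl m hm] at hw
    cases hw
  · have : k = k' := by
      rcases lt_trichotomy k k' with h | h | h
      · rw [hl _ h] at hk'; cases hk'
      · exact h
      · rw [hl' _ h] at hk; cases hk
    subst this
    funext n
    rw [h1, h1']

theorem exM_lang : exM.Lang (BuchiAcc exα) = {w | ∃ k, w k = true} := by
  classical
  ext w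
  constructor
  · rintro ⟨r, hr, ha⟩
    rcases exM_acc hr ha with ⟨hi, -⟩ | ⟨k, hk, -⟩
    · obtain ⟨m, -, hm⟩ := hi 0
      exact ⟨m, hm⟩
    · exact ⟨k, hk⟩
  · rintro ⟨k, hk⟩
    by_cases hi : ∀ n, ∃ m, n ≤ m ∧ w m = true
    · refine ⟨fun n => (true, Nat.casesOn (motive := fun _ => Bool) n false w), ⟨by simp [exM], fun i => ?_⟩, (true, true), ?_, rfl⟩
      · simp [exM]
      · intro n
        obtain ⟨m, hm, hw⟩ := hi n
        exact ⟨m + 1, by omega, by simp [hw]⟩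
    · push Not at hi
      obtain ⟨j, hj, hl⟩ : ∃ j, w j = true ∧ ∀ m, j < m → w m = false := by
        have hN := Nat.find_spec hi
        have hmin := fun m hm => Nat.find_min (m := m) hi hm
        generalize Nat.find hi = N at hN hmin
        cases N with
        | zero => exact absurd hk (hN k (Nat.zero_le _))
        | succ j =>
          refine ⟨j, ?_, fun m hm => by simpa using hN m hm⟩
          by_contra hj
          refine hmin j (Nat.lt_succ_self j) (fun m hm => ?_)
          rcases Nat.eq_or_lt_of_le hm with rfl | h
          · exact hj
          · exact hN m h
      refine ⟨fun n => (false, decide (j < n)), ⟨by simp [exM], fun i => ?_⟩,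
        (false, true), ?_, rfl⟩
      · simp only [exM, Set.mem_ofPred_eq, decide_eq_true_eq, decide_eq_false_iff_not]
        refine ⟨trivial, by simp, fun _ => ⟨fun h => ⟨hl i h, by omega⟩, fun h h' => ?_⟩⟩
        obtain rfl : j = i := by omega
        exact hj
      · intro n
        exact ⟨n + j + 1, by omega, Prod.ext rfl (decide_eq_true (show j < n + j + 1 by omega))⟩

/-- deterministic co-Büchi witness -/
def exD : Auto Bool Bool := ⟨{false}, fun q x => {q || x}⟩

theorem exD_lang : exD.Lang (CoBuchiAcc {false}) = {w | ∃ k, w k = true} := by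
  ext w
  constructor
  · rintro ⟨r, hr, ha⟩
    by_contra hw
    have hw' : ∀ k, w k = false := by simpa using hw
    have h : ∀ n, r n = false := by
      intro n
      induction n with
      | zero => exact hr.1
      | succ n ih =>
        have h2 : r (n + 1) = (r n || w n) := hr.2 n
        rw [h2, ih, hw']; rfl
    have : false ∈ InfOcc r ∩ {false} := ⟨fun n => ⟨n, le_rfl, h n⟩, rfl⟩
    rw [ha] at this
    exact this
  · rintro ⟨k, hk⟩
    let r : ℕ → Bool := fun n => Nat.rec false (fun i q => q || w i) n
    have hs : ∀ n, r (n + 1) = (r n || w n) := fun n => rfl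
    refine ⟨r, ⟨rfl, fun i => rfl⟩, ?_⟩
    have h : ∀ d, r (k + 1 + d) = true := by
      intro d
      induction d with
      | zero => rw [Nat.add_zero, hs, hk, Bool.or_true]
      | succ d ih => rw [← Nat.add_assoc, hs, ih, Bool.true_or]
    refine Set.eq_empty_iff_forall_notMem.2 ?_
    rintro q ⟨hq, hq'⟩
    obtain ⟨m, hm, hr⟩ := hq (k + 1)
    obtain ⟨d, rfl⟩ := Nat.exists_eq_add_of_le hm
    rw [h, show q = false from hq'] at hr
    cases hr

theorem exM_no (α' : Set (Bool × Bool)) :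
    exM.Lang (CoBuchiAcc α') ≠ {w | ∃ k, w k = true} := by
  intro he
  have hmem : ∀ c : Bool, (c, false) ∈ α' := by
    intro c
    by_contra hc
    have : (fun _ => false) ∈ exM.Lang (CoBuchiAcc α') := by
      refine ⟨fun _ => (c, false), ⟨rfl, fun i => by simp [exM]⟩, ?_⟩
      refine Set.eq_empty_iff_forall_notMem.2 ?_
      rintro q ⟨hq, hq'⟩
      obtain ⟨m, -, rfl⟩ := hq 0
      exact hc hq'
    rw [he] at this
    obtain ⟨k, hk⟩ := this
    cases hk
  have h : (fun n : ℕ => decide (n % 2 = 0)) ∈ exM.Lang (CoBuchiAcc α') := by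
    rw [he]; exact ⟨0, by simp⟩
  obtain ⟨r, hr, ha⟩ := h
  have key : ∀ c, (c, false) ∉ InfOcc r := by
    intro c hc
    have : (c, false) ∈ InfOcc r ∩ α' := ⟨hc, hmem c⟩
    rw [ha] at this
    exact this
  cases h0 : (r 0).1 with
  | true =>
    refine key true (fun n => ⟨2 * n + 1 + 1, by omega, ?_⟩)
    rw [(exM_one hr h0).2]
    simp
  | false =>
    by_cases hN : ∃ N, (r N).2 = true
    · obtain ⟨k, -, hl, -⟩ := exM_two hr h0 hN
      have := hl (2 * k + 2) (by omega)
      simp at this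
    · push Not at hN
      exact key false (fun n => ⟨n, le_rfl, Prod.ext (by rw [exM_comp hr, h0]) (by simpa using hN n)⟩)

/-- There is an unambiguous nondeterministic Büchi automaton whose
language is DCW-realizable, yet no co-Büchi condition on the same structure yields an
equivalent automaton. -/
theorem stmt5 :
    ∃ (A Q : Type) (_ : Fintype A) (_ : Fintype Q)
      (M : Auto A Q) (α : Set Q),
      Unambiguous M (BuchiAcc α) ∧
      (∃ (Q' : Type) (_ : Fintype Q') (D : Auto A Q') (β : Set Q'),
        D.IsDet ∧ D.Lang (CoBuchiAcc β) = M.Lang (BuchiAcc α)) ∧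
      ¬ ∃ α' : Set Q, M.Lang (CoBuchiAcc α') = M.Lang (BuchiAcc α) := by
  exact ⟨Bool, Bool × Bool, inferInstance, inferInstance, exM, exα, exM_unamb,
    ⟨Bool, inferInstance, exD, {false},
      ⟨⟨false, rfl⟩, fun _ _ => Set.subsingleton_singleton⟩, by rw [exD_lang, exM_lang]⟩,
    fun ⟨α', h⟩ => exM_no α' (h.trans exM_lang)⟩

end GFG
end
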